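/- arXiv:1504.06790 — 2 statements merged into one kernel-verified Lean document; each statement's English description precedes it below -/
import Mathlib

section
/- Let {A₁,...,A_k} and {B₁,...,B_k} be m×n complex matrices. Then the following are equivalent: (a) there exist unitary matrices U (m×m) and V (n×n) with Uᴴ Aᵢ V = Bᵢ for all i; (b) the family {Aᵢ Aⱼᴴ : 1 ≤ i ≤ j ≤ k} is simultaneously unitarily similar to {Bᵢ Bⱼᴴ : 1 ≤ i ≤ j ≤ k}; (c) tr(w({Aᵢ Aⱼᴴ})) = tr(w({Bᵢ Bⱼᴴ})) for every word w in the k² products Aᵢ Aⱼᴴ and the corresponding products Bᵢ Bⱼᴴ. -/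
open Matrix

open scoped ComplexOrder

namespace Matrix

variable {m n N ι : Type*} [Fintype m] [Fintype n] [Fintype N] [DecidableEq N]

/-- Every subspace of matrices has a finite family in which its elements expand with coefficients
given by the Frobenius inner product. -/
theorem exists_frobenius_expansion (S : Submodule ℂ (Matrix N N ℂ)) :
    ∃ (r : ℕ) (e : Fin r → Matrix N N ℂ), (∀ i, e i ∈ S) ∧
      ∀ x ∈ S, ∑ i, (x * (e i)ᴴ).trace • e i = x := by
  let _ := toMatrixNormedAddCommGroup (1 : Matrix N N ℂ) PosDef.one
  let _ := toMatrixInnerProductSpace (1 : Matrix N N ℂ) PosSemidef.one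
  let b := stdOrthonormalBasis ℂ S
  refine ⟨_, fun i => b i, fun i => (b i).2, fun x hx => ?_⟩
  have h := congrArg Subtype.val (b.sum_repr' ⟨x, hx⟩)
  rw [Submodule.coe_sum] at h
  refine Eq.trans (Finset.sum_congr rfl fun i _ => ?_) h
  change _ = (x * 1 * (b i : Matrix N N ℂ)ᴴ).trace • (b i : Matrix N N ℂ)
  rw [mul_one]

/-- Averaging `Z` over such a family in a subspace produces a matrix commuting with every `c`
such that the subspace is stable under left multiplication by `c` and `cᴴ`. -/
theorem commute_sum_mul_mul_conjTranspose {r : ℕ} {S : Submodule ℂ (Matrix N N ℂ)}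
    {e : Fin r → Matrix N N ℂ} (heS : ∀ i, e i ∈ S)
    (he : ∀ x ∈ S, ∑ i, (x * (e i)ᴴ).trace • e i = x) {c : Matrix N N ℂ}
    (hc : ∀ x ∈ S, c * x ∈ S) (hc' : ∀ x ∈ S, cᴴ * x ∈ S) (Z : Matrix N N ℂ) :
    Commute c (∑ i, e i * Z * (e i)ᴴ) := by
  have left (j) : c * e j = ∑ i, (c * e j * (e i)ᴴ).trace • e i :=
    (he _ (hc _ (heS j))).symm
  have right (i) : (e i)ᴴ * c = ∑ j, (c * e j * (e i)ᴴ).trace • (e j)ᴴ := by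
    have h := congrArg conjTranspose (he _ (hc' _ (heS i)))
    rw [conjTranspose_mul, conjTranspose_conjTranspose] at h
    rw [← h, conjTranspose_sum]
    refine Finset.sum_congr rfl fun j _ => ?_
    rw [conjTranspose_smul, ← trace_conjTranspose]
    simp only [conjTranspose_mul, conjTranspose_conjTranspose]
    rw [trace_mul_comm, Matrix.mul_assoc, trace_mul_comm, Matrix.mul_assoc, trace_mul_comm]
  calc c * ∑ j, e j * Z * (e j)ᴴ
      = ∑ j, c * e j * Z * (e j)ᴴ := by simp only [Finset.mul_sum, Matrix.mul_assoc]
    _ = ∑ j, ∑ i, (c * e j * (e i)ᴴ).trace • (e i * Z * (e j)ᴴ) := by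
        refine Finset.sum_congr rfl fun j _ => ?_
        conv_lhs => rw [left j]
        simp only [Finset.sum_mul, smul_mul_assoc]
    _ = ∑ i, ∑ j, (c * e j * (e i)ᴴ).trace • (e i * Z * (e j)ᴴ) := Finset.sum_comm
    _ = ∑ i, e i * Z * ((e i)ᴴ * c) := by
        refine Finset.sum_congr rfl fun i _ => ?_
        rw [right i]
        simp only [Finset.mul_sum, mul_smul_comm]
    _ = (∑ i, e i * Z * (e i)ᴴ) * c := by simp only [Finset.sum_mul, Matrix.mul_assoc]

/-- A nonzero projection `P` with the same traces as `Q` against all words in a self-adjoint family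
is linked to `Q` by some matrix in the commutant of the family. -/
theorem exists_commute_mul_mul_ne_zero {X : ι → Matrix N N ℂ}
    (hX : ∀ s, ∃ t, X t = (X s)ᴴ) {P Q : Matrix N N ℂ} (hP : Pᴴ = P) (hP0 : P * P = P)
    (hPne : P ≠ 0)
    (htr : ∀ w : List ι, ((w.map X).prod * P).trace = ((w.map X).prod * Q).trace) :
    ∃ T : Matrix N N ℂ, (∀ s, Commute (X s) T) ∧ Q * T * P ≠ 0 := by
  set S : Submodule ℂ (Matrix N N ℂ) := Submodule.span ℂ (Set.range fun w : List ι => (w.map X).prod)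
  obtain ⟨r, e, heS, he⟩ := exists_frobenius_expansion S
  have hmul (s) : ∀ x ∈ S, X s * x ∈ S := by
    intro x hx
    induction hx using Submodule.span_induction with
    | mem x hx =>
      obtain ⟨w, rfl⟩ := hx
      exact Submodule.subset_span ⟨s :: w, by simp⟩
    | zero => simp
    | add x y _ _ hx hy => rw [mul_add]; exact S.add_mem hx hy
    | smul a x _ hx => rw [mul_smul_comm]; exact S.smul_mem a hx
  have htrS : ∀ x ∈ S, (x * P).trace = (x * Q).trace := by
    intro x hx
    induction hx using Submodule.span_induction with
    | mem x hx => obtain ⟨w, rfl⟩ := hx; exact htr w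
    | zero => simp
    | add x y _ _ hx hy => simp [add_mul, hx, hy]
    | smul a x _ hx => simp [hx]
  by_contra! H
  have key (Z : Matrix N N ℂ) : ∑ i, Q * e i * Z * ((e i)ᴴ * P) = 0 := by
    have h := H (∑ i, e i * Z * (e i)ᴴ) fun s => by
      obtain ⟨t, ht⟩ := hX s
      exact commute_sum_mul_mul_conjTranspose heS he (hmul s) (ht ▸ hmul t) Z
    simpa only [Finset.mul_sum, Finset.sum_mul, Matrix.mul_assoc] using h
  have hsum : ∑ i, (Q * e i).trace * ((e i)ᴴ * P).trace = 0 := by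
    have h : ∑ a, ∑ b, (∑ i, Q * e i * single a b (1 : ℂ) * ((e i)ᴴ * P) : Matrix N N ℂ) a b = 0 := by
      simp [key]
    rw [← h]
    simp only [Matrix.sum_apply, trace, diag_apply, Finset.sum_mul_sum]
    rw [Finset.sum_comm]
    refine Finset.sum_congr rfl fun a _ => ?_
    rw [Finset.sum_comm]
    refine Finset.sum_congr rfl fun b _ => Finset.sum_congr rfl fun i _ => ?_
    rw [Matrix.mul_apply (M := Q * e i * single a b (1 : ℂ)), Finset.sum_eq_single b]
    · simp
    · intro c _ hc
      rw [mul_single_apply_of_ne _ _ _ _ _ hc, zero_mul]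
    · simp
  have hzero (i) : (e i * P).trace = 0 := by
    have hterm (i) : (Q * e i).trace * ((e i)ᴴ * P).trace =
        ((Complex.normSq (e i * P).trace : ℝ) : ℂ) := by
      rw [trace_mul_comm Q, ← htrS _ (heS i), ← Complex.mul_conj, starRingEnd_apply,
        ← trace_conjTranspose, conjTranspose_mul, hP, trace_mul_comm P]
    simp only [hterm] at hsum
    rw [← Complex.ofReal_sum, Complex.ofReal_eq_zero,
      Finset.sum_eq_zero_iff_of_nonneg fun _ _ => Complex.normSq_nonneg _] at hsum
    exact Complex.normSq_eq_zero.mp (hsum i (Finset.mem_univ i))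
  have htrP : P.trace = 0 := by
    have h1 : (1 : Matrix N N ℂ) ∈ S := Submodule.subset_span ⟨[], by simp⟩
    rw [← one_mul P, ← he 1 h1, Finset.sum_mul, trace_sum]
    exact Finset.sum_eq_zero fun i _ => by rw [smul_mul_assoc, trace_smul, hzero, smul_zero]
  refine hPne (trace_conjTranspose_mul_self_eq_zero_iff.mp ?_)
  rw [hP, hP0, htrP]

/-- The inverse square root of a positive semidefinite matrix on its range. -/
theorem PosSemidef.exists_inv_sqrt {M : Matrix N N ℂ} (hM : M.PosSemidef) :
    ∃ h : Matrix N N ℂ, hᴴ = h ∧ (∀ c, Commute M c → Commute h c) ∧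
      M * h * h * M = M ∧ h * M * h * h = h := by
  have hs : IsSelfAdjoint M := hM.isHermitian
  have hcont (f : ℝ → ℝ) : ContinuousOn f (spectrum ℝ M) :=
    (Matrix.finite_real_spectrum (A := M)).continuousOn f
  let g : ℝ → ℝ := fun x => (√x)⁻¹
  have hg : ∀ x ∈ spectrum ℝ M, 0 ≤ x := by
    open scoped MatrixOrder in
    exact fun x hx => spectrum_nonneg_of_nonneg hM.nonneg hx
  have hid : cfc (fun x : ℝ => x) M = M := cfc_id' ℝ M
  refine ⟨cfc g M, cfc_predicate (p := IsSelfAdjoint) g M, fun c hc => hc.cfc_real g, ?_, ?_⟩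
  · have h : cfc (fun x => x * g x * g x * x) M = M * cfc g M * cfc g M * M := by
      simp only [cfc_mul _ _ M (hcont _) (hcont _), hid]
    rw [← h]
    refine (cfc_congr fun x hx => ?_).trans hid
    obtain h0 | h0 := (hg x hx).eq_or_lt
    · simp [← h0]
    · have := Real.mul_self_sqrt (hg x hx)
      have := (Real.sqrt_pos.mpr h0).ne'
      simp only [g]
      field_simp
      nlinarith
  · have h : cfc (fun x => g x * x * g x * g x) M = cfc g M * M * cfc g M * cfc g M := by
      simp only [cfc_mul _ _ M (hcont _) (hcont _), hid]
    rw [← h]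
    refine cfc_congr fun x hx => ?_
    obtain h0 | h0 := (hg x hx).eq_or_lt
    · simp [g, ← h0]
    · have := Real.mul_self_sqrt (hg x hx)
      have := (Real.sqrt_pos.mpr h0).ne'
      simp only [g]
      field_simp
      nlinarith

theorem mul_eq_zero_of_mul_mul_conjTranspose {l : Type*} [Fintype l] {Y : Matrix l m ℂ}
    {T : Matrix m n ℂ} (h : Y * (T * Tᴴ) * Yᴴ = 0) : Y * T = 0 := by
  rw [← self_mul_conjTranspose_eq_zero, conjTranspose_mul, ← h]
  simp only [Matrix.mul_assoc]

/-- The partial isometry in a polar decomposition of `T`. -/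
theorem exists_partialIsometry_of_ne_zero {T : Matrix N N ℂ} (hT : T ≠ 0) :
    ∃ V : Matrix N N ℂ, V ≠ 0 ∧ V * Vᴴ * V = V ∧
      (∀ c, Commute c T → Commute cᴴ T → Commute c V) ∧
      (∀ P, Pᴴ = P → T * P = T → V * P = V) ∧ (∀ Q, Q * T = T → Q * V = V) := by
  obtain ⟨h, hh, hcomm, h1, h2⟩ := (posSemidef_conjTranspose_mul_self T).exists_inv_sqrt
  have hM : h * (Tᴴ * T) = Tᴴ * T * h := (hcomm _ (Commute.refl _)).eq
  refine ⟨T * h, fun h0 => hT ?_, ?_, fun c hc hc' => ?_, fun P hP hTP => ?_, fun Q hQ => ?_⟩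
  · rw [← conjTranspose_mul_self_eq_zero, ← h1, Matrix.mul_assoc Tᴴ, h0]
    simp
  · rw [conjTranspose_mul, hh]
    calc T * h * (h * Tᴴ) * (T * h) = T * (h * (h * (Tᴴ * T)) * h) := by
          simp only [Matrix.mul_assoc]
      _ = T * (h * (Tᴴ * T * h) * h) := by rw [hM]
      _ = T * (h * (Tᴴ * T) * h * h) := by simp only [Matrix.mul_assoc]
      _ = T * h := by rw [h2]
  · have hT' : Commute c Tᴴ := by
      have := congrArg conjTranspose hc'.eq
      simp only [conjTranspose_mul, conjTranspose_conjTranspose] at this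
      exact this.symm
    exact hc.mul_right (hcomm c (hT'.mul_right hc).symm).symm
  · have hPT : P * Tᴴ = Tᴴ := by
      have := congrArg conjTranspose hTP
      rwa [conjTranspose_mul, hP] at this
    have : h * P = P * h := (hcomm P (show _ * _ = _ * _ by
      rw [Matrix.mul_assoc, hTP, ← Matrix.mul_assoc, hPT])).eq
    rw [Matrix.mul_assoc, this, ← Matrix.mul_assoc, hTP]
  · rw [← Matrix.mul_assoc, hQ]

theorem rank_sub_lt_of_idempotent {P E : Matrix N N ℂ} (hP : P * P = P) (hE : E * E = E)
    (hPE : P * E = E) (hEP : E * P = E) (hE0 : E ≠ 0) : (P - E).rank < P.rank := by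
  have hle : LinearMap.range (P - E).mulVecLin ≤ LinearMap.range P.mulVecLin := by
    rintro _ ⟨v, rfl⟩
    exact ⟨(P - E) *ᵥ v, by
      rw [mulVecLin_apply, mulVecLin_apply, mulVec_mulVec, mul_sub, hP, hPE]⟩
  refine Submodule.finrank_lt_finrank_of_lt (lt_of_le_of_ne hle fun heq => hE0 ?_)
  refine Matrix.ext_of_mulVec_single fun j => ?_
  have hmem : E *ᵥ Pi.single j 1 ∈ LinearMap.range (P - E).mulVecLin :=
    heq ▸ ⟨E *ᵥ Pi.single j 1, by rw [mulVecLin_apply, mulVec_mulVec, hPE]⟩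
  obtain ⟨v, hv⟩ := hmem
  rw [mulVecLin_apply] at hv
  have := congrArg (E *ᵥ ·) hv
  simp only [mulVec_mulVec, mul_sub, hE, hEP, sub_self, zero_mulVec] at this
  rw [← this, zero_mulVec]

/-- Two projections in the commutant of a self-adjoint family `X` that have the same traces against
all words in `X` are equivalent through a partial isometry in the commutant. -/
theorem exists_commute_partialIsometry {X : ι → Matrix N N ℂ} (hX : ∀ s, ∃ t, X t = (X s)ᴴ)
    {P Q : Matrix N N ℂ} (hP : Pᴴ = P) (hPP : P * P = P) (hQ : Qᴴ = Q) (hQQ : Q * Q = Q)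
    (hPX : ∀ s, Commute (X s) P) (hQX : ∀ s, Commute (X s) Q)
    (htr : ∀ w : List ι, ((w.map X).prod * P).trace = ((w.map X).prod * Q).trace) :
    ∃ T : Matrix N N ℂ, (∀ s, Commute (X s) T) ∧ Tᴴ * T = P ∧ T * Tᴴ = Q := by
  induction hr : P.rank using Nat.strong_induction_on generalizing P Q with
  | _ r ih =>
  by_cases hP0 : P = 0
  · have hQ0 : Q = 0 := by
      rw [← trace_conjTranspose_mul_self_eq_zero_iff, hQ, hQQ]
      simpa [hP0] using (htr []).symm
    exact ⟨0, by simp, by simp [hP0], by simp [hQ0]⟩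
  obtain ⟨T, hTX, hT0⟩ := exists_commute_mul_mul_ne_zero hX hP hPP hP0 htr
  obtain ⟨V, hV0, hVV, hVcomm, hVP, hQV⟩ := exists_partialIsometry_of_ne_zero hT0
  have hTX' (s) : Commute (X s) (Q * T * P) := ((hQX s).mul_right (hTX s)).mul_right (hPX s)
  have hVX (s) : Commute (X s) V := by
    obtain ⟨t, ht⟩ := hX s
    exact hVcomm _ (hTX' s) (ht ▸ hTX' t)
  have hVX' (s) : Commute (X s) Vᴴ := by
    obtain ⟨t, ht⟩ := hX s
    have := congrArg conjTranspose (hVX t).eq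
    simp only [conjTranspose_mul, ht, conjTranspose_conjTranspose] at this
    exact this.symm
  replace hVP : V * P = V := hVP P hP (by rw [Matrix.mul_assoc, hPP])
  replace hQV : Q * V = V := hQV Q (by simp only [← Matrix.mul_assoc, hQQ])
  have hPV : P * Vᴴ = Vᴴ := by
    have := congrArg conjTranspose hVP
    rwa [conjTranspose_mul, hP] at this
  have hVQ : Vᴴ * Q = Vᴴ := by
    have := congrArg conjTranspose hQV
    rwa [conjTranspose_mul, hQ] at this
  have hVV' : Vᴴ * V * Vᴴ = Vᴴ := by
    have := congrArg conjTranspose hVV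
    simpa only [conjTranspose_mul, conjTranspose_conjTranspose, Matrix.mul_assoc] using this
  have hEE : Vᴴ * V * (Vᴴ * V) = Vᴴ * V := by rw [← Matrix.mul_assoc, hVV']
  have hFF : V * Vᴴ * (V * Vᴴ) = V * Vᴴ := by rw [← Matrix.mul_assoc, hVV]
  have hPE : P * (Vᴴ * V) = Vᴴ * V := by rw [← Matrix.mul_assoc, hPV]
  have hEP : Vᴴ * V * P = Vᴴ * V := by rw [Matrix.mul_assoc, hVP]
  have hQF : Q * (V * Vᴴ) = V * Vᴴ := by rw [← Matrix.mul_assoc, hQV]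
  have hFQ : V * Vᴴ * Q = V * Vᴴ := by rw [Matrix.mul_assoc, hVQ]
  obtain ⟨W, hWX, hW1, hW2⟩ := ih (P - Vᴴ * V).rank
    (hr ▸ rank_sub_lt_of_idempotent hPP hEE hPE hEP
      (mt conjTranspose_mul_self_eq_zero.mp hV0))
    (P := P - Vᴴ * V) (Q := Q - V * Vᴴ) (by simp [hP])
    (by simp only [sub_mul, mul_sub, hPP, hPE, hEP, hEE]; abel)
    (by simp [hQ])
    (by simp only [sub_mul, mul_sub, hQQ, hQF, hFQ, hFF]; abel)
    (fun s => (hPX s).sub_right ((hVX' s).mul_right (hVX s)))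
    (fun s => (hQX s).sub_right ((hVX s).mul_right (hVX' s)))
    (fun w => by
      have hw : Commute (w.map X).prod V := Commute.list_prod_left _ _ fun x hx => by
        obtain ⟨s, -, rfl⟩ := List.mem_map.mp hx
        exact hVX s
      rw [mul_sub, mul_sub, trace_sub, trace_sub, htr, ← Matrix.mul_assoc _ V, hw.eq,
        ← Matrix.mul_assoc, trace_mul_comm _ V, Matrix.mul_assoc V]) rfl
  have hWV : Vᴴ * W = 0 := mul_eq_zero_of_mul_mul_conjTranspose <| by
    rw [hW2, conjTranspose_conjTranspose, mul_sub, sub_mul, hVQ, ← Matrix.mul_assoc, hVV', sub_self]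
  have hVW : V * Wᴴ = 0 := mul_eq_zero_of_mul_mul_conjTranspose <| by
    rw [conjTranspose_conjTranspose, hW1, mul_sub, sub_mul, hVP, ← Matrix.mul_assoc, hVV, sub_self]
  have hWV' : Wᴴ * V = 0 := by simpa using congrArg conjTranspose hWV
  have hVW' : W * Vᴴ = 0 := by simpa using congrArg conjTranspose hVW
  refine ⟨V + W, fun s => (hVX s).add_right (hWX s), ?_, ?_⟩
  · simp [add_mul, mul_add, hWV, hWV', hW1]
  · simp [add_mul, mul_add, hVW, hVW', hW2]

/-- **Specht's theorem** for self-adjoint families: equality of the traces of all words implies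
simultaneous unitary similarity. -/
theorem exists_unitary_conj_of_trace_eq {C D : ι → Matrix N N ℂ}
    (hCD : ∀ s, ∃ t, C t = (C s)ᴴ ∧ D t = (D s)ᴴ)
    (htr : ∀ w : List ι, (w.map C).prod.trace = (w.map D).prod.trace) :
    ∃ U : Matrix N N ℂ, U * Uᴴ = 1 ∧ ∀ s, Uᴴ * C s * U = D s := by
  let X (s : ι) : Matrix (N ⊕ N) (N ⊕ N) ℂ := fromBlocks (C s) 0 0 (D s)
  have hprod (w : List ι) :
      (w.map X).prod = fromBlocks (w.map C).prod 0 0 (w.map D).prod := by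
    induction w with
    | nil => simp
    | cons s w ih => simp [ih, X, fromBlocks_multiply]
  obtain ⟨T, hTX, hT1, hT2⟩ := exists_commute_partialIsometry (X := X)
    (P := fromBlocks 1 0 0 0) (Q := fromBlocks 0 0 0 1)
    (fun s => by
      obtain ⟨t, hC, hD⟩ := hCD s
      exact ⟨t, by simp [X, fromBlocks_conjTranspose, hC, hD]⟩)
    (by simp [fromBlocks_conjTranspose]) (by simp [fromBlocks_multiply])
    (by simp [fromBlocks_conjTranspose]) (by simp [fromBlocks_multiply])
    (fun s => by simp [X, Commute, SemiconjBy, fromBlocks_multiply])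
    (fun s => by simp [X, Commute, SemiconjBy, fromBlocks_multiply])
    (fun w => by
      simpa [hprod, fromBlocks_multiply, trace] using htr w)
  obtain ⟨a, b, c, d, rfl⟩ : ∃ a b c d, T = fromBlocks a b c d :=
    ⟨_, _, _, _, (fromBlocks_toBlocks T).symm⟩
  have hl : fromBlocks 1 0 0 0 * fromBlocks a b c d = (0 : Matrix (N ⊕ N) (N ⊕ N) ℂ) :=
    mul_eq_zero_of_mul_mul_conjTranspose <| by
      rw [hT2]; simp [fromBlocks_multiply]
  have hr : fromBlocks 0 0 0 1 * (fromBlocks a b c d)ᴴ = (0 : Matrix (N ⊕ N) (N ⊕ N) ℂ) :=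
    mul_eq_zero_of_mul_mul_conjTranspose <| by
      rw [conjTranspose_conjTranspose, hT1]; simp [fromBlocks_multiply]
  simp only [fromBlocks_conjTranspose, fromBlocks_multiply, ← fromBlocks_zero, fromBlocks_inj]
    at hl hr
  simp at hl hr
  obtain ⟨rfl, rfl⟩ := hl
  obtain ⟨-, rfl⟩ := hr
  simp [fromBlocks_conjTranspose, fromBlocks_multiply, fromBlocks_inj] at hT1 hT2
  refine ⟨cᴴ, by simpa using hT1, fun s => ?_⟩
  have hs := (hTX s).eq
  simp [X, fromBlocks_multiply, fromBlocks_inj] at hs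
  rw [conjTranspose_conjTranspose, ← hs, Matrix.mul_assoc, hT2, Matrix.mul_one]

/-- Matrices with the same Gram matrix of rows differ by a unitary factor on the right. -/
theorem exists_unitary_mul_eq_of_mul_conjTranspose_eq [DecidableEq m] {X Y : Matrix m N ℂ}
    (hXY : X * Xᴴ = Y * Yᴴ) : ∃ V : Matrix N N ℂ, V * Vᴴ = 1 ∧ X * V = Y := by
  obtain ⟨h, hh, -, h1, h2⟩ := (posSemidef_self_mul_conjTranspose X).exists_inv_sqrt
  set M := X * Xᴴ with hM
  have hrange {Z : Matrix m N ℂ} (hZ : Z * Zᴴ = M) : M * h * h * Z = Z := by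
    have : (M * h * h - 1) * Z = 0 := mul_eq_zero_of_mul_mul_conjTranspose <| by
      rw [hZ, sub_mul, h1, Matrix.one_mul, sub_self, Matrix.zero_mul]
    rwa [Matrix.sub_mul, Matrix.one_mul, sub_eq_zero] at this
  have hX := hrange hM.symm
  have hY := hrange hXY.symm
  have hhM : h * h * M * h * h = h * h := by
    rw [Matrix.mul_assoc h h M]
    simpa only [Matrix.mul_assoc] using congrArg (h * ·) h2
  set V := Xᴴ * (h * h) * Y with hV
  have hV' : Vᴴ = Yᴴ * (h * h) * X := by
    simp only [hV, conjTranspose_mul, conjTranspose_conjTranspose, hh, Matrix.mul_assoc]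
  have hVV' : V * Vᴴ = Xᴴ * (h * h) * X := by
    conv_rhs => rw [← hhM, hXY]
    rw [hV', hV]
    simp only [Matrix.mul_assoc]
  have hV'V : Vᴴ * V = Yᴴ * (h * h) * Y := by
    conv_rhs => rw [← hhM, hM]
    rw [hV', hV]
    simp only [Matrix.mul_assoc]
  have hXV : X * V = Y := by
    rw [← hY, hM, hV]
    simp only [Matrix.mul_assoc]
  have hXP : X * (V * Vᴴ) = X := by
    rw [hVV']
    conv_rhs => rw [← hX, hM]
    simp only [Matrix.mul_assoc]
  have hYQ : Y * (Vᴴ * V) = Y := by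
    rw [hV'V]
    conv_rhs => rw [← hY, hXY]
    simp only [Matrix.mul_assoc]
  have hVV : V * (Vᴴ * V) = V := by
    conv_lhs => rw [hV, Matrix.mul_assoc, hYQ]
  have hVV2 : V * Vᴴ * V = V := by rw [Matrix.mul_assoc, hVV]
  obtain ⟨T, -, hT1, hT2⟩ := exists_commute_partialIsometry (ι := Empty) (X := Empty.elim)
    (P := 1 - Vᴴ * V) (Q := 1 - V * Vᴴ) (fun s => s.elim) (by simp)
    (by simp [mul_sub, sub_mul, Matrix.mul_assoc, hVV]) (by simp)
    (by simp [mul_sub, sub_mul, ← Matrix.mul_assoc, hVV2])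
    (fun s => s.elim) (fun s => s.elim)
    (fun w => by
      rw [Subsingleton.elim w []]
      simp [trace_mul_comm V])
  have hXT : X * T = 0 := mul_eq_zero_of_mul_mul_conjTranspose <| by
    rw [hT2, Matrix.mul_sub, hXP, Matrix.mul_one, sub_self, Matrix.zero_mul]
  have hVT : V * Tᴴ = 0 := mul_eq_zero_of_mul_mul_conjTranspose <| by
    rw [conjTranspose_conjTranspose, hT1, mul_sub, hVV, mul_one, sub_self, zero_mul]
  have hTV : T * Vᴴ = 0 := by simpa using congrArg conjTranspose hVT
  refine ⟨V + T, ?_, by rw [Matrix.mul_add, hXT, hXV, add_zero]⟩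
  simp [add_mul, mul_add, hVT, hTV, hT2]

end Matrix

theorem unitary_equivalence_tfae (m n k : ℕ)
    (A B : Fin k → Matrix (Fin m) (Fin n) ℂ) :
    List.TFAE [
      (∃ (U : Matrix (Fin m) (Fin m) ℂ) (V : Matrix (Fin n) (Fin n) ℂ),
        U * Uᴴ = 1 ∧ V * Vᴴ = 1 ∧ ∀ i, Uᴴ * A i * V = B i),
      (∃ U : Matrix (Fin m) (Fin m) ℂ, U * Uᴴ = 1 ∧
        ∀ i j : Fin k, i ≤ j → Uᴴ * (A i * (A j)ᴴ) * U = B i * (B j)ᴴ),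
      (∀ w : List (Fin k × Fin k),
        ((w.map (fun p => A p.1 * (A p.2)ᴴ)).prod).trace =
          ((w.map (fun p => B p.1 * (B p.2)ᴴ)).prod).trace)] := by
  have all_pairs {U : Matrix (Fin m) (Fin m) ℂ}
      (hU : ∀ i j : Fin k, i ≤ j → Uᴴ * (A i * (A j)ᴴ) * U = B i * (B j)ᴴ) (i j : Fin k) :
      Uᴴ * (A i * (A j)ᴴ) * U = B i * (B j)ᴴ := by
    obtain hij | hij := le_total i j
    · exact hU i j hij
    · simpa [Matrix.mul_assoc] using congrArg conjTranspose (hU j i hij)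
  tfae_have 1 → 2 := by
    rintro ⟨U, V, hU, hV, h⟩
    refine ⟨U, hU, fun i j _ => ?_⟩
    simp only [← h, conjTranspose_mul, conjTranspose_conjTranspose]
    calc Uᴴ * (A i * (A j)ᴴ) * U = Uᴴ * (A i * (V * Vᴴ) * (A j)ᴴ) * U := by
          rw [hV, Matrix.mul_one]
      _ = Uᴴ * A i * V * (Vᴴ * ((A j)ᴴ * U)) := by simp only [Matrix.mul_assoc]
  tfae_have 2 → 3 := by
    rintro ⟨U, hU, h⟩ w
    have hw : (w.map fun p => B p.1 * (B p.2)ᴴ).prod =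
        Uᴴ * (w.map fun p => A p.1 * (A p.2)ᴴ).prod * U := by
      induction w with
      | nil => simpa using (mul_eq_one_comm.mp hU).symm
      | cons p w ih =>
        rw [List.map_cons, List.prod_cons, ih, ← all_pairs h, List.map_cons, List.prod_cons]
        set W := (w.map fun p => A p.1 * (A p.2)ᴴ).prod
        calc Uᴴ * (A p.1 * (A p.2)ᴴ) * U * (Uᴴ * W * U)
            = Uᴴ * (A p.1 * (A p.2)ᴴ) * (U * Uᴴ) * W * U := by simp only [Matrix.mul_assoc]
          _ = Uᴴ * (A p.1 * (A p.2)ᴴ * W) * U := by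
            rw [hU, Matrix.mul_one, Matrix.mul_assoc Uᴴ]
    rw [hw, Matrix.mul_assoc, trace_mul_comm, Matrix.mul_assoc, hU, Matrix.mul_one]
  tfae_have 3 → 2 := fun h => by
    obtain ⟨U, hU, hUw⟩ := exists_unitary_conj_of_trace_eq
      (fun p : Fin k × Fin k => ⟨p.swap, by simp, by simp⟩) h
    exact ⟨U, hU, fun i j _ => hUw (i, j)⟩
  tfae_have 2 → 1 := by
    rintro ⟨U, hU, h⟩
    obtain ⟨V, hV, hXV⟩ := exists_unitary_mul_eq_of_mul_conjTranspose_eq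
      (X := Matrix.of fun (p : Fin k × Fin m) => (Uᴴ * A p.1) p.2)
      (Y := Matrix.of fun (p : Fin k × Fin m) => B p.1 p.2) (by
        ext ⟨i, a⟩ ⟨j, b⟩
        have hij : Uᴴ * A i * (Uᴴ * A j)ᴴ = B i * (B j)ᴴ := by
          rw [← all_pairs h i j, conjTranspose_mul, conjTranspose_conjTranspose]
          simp only [Matrix.mul_assoc]
        exact congrFun (congrFun hij a) b)
    refine ⟨U, V, hU, hV, fun i => ?_⟩
    ext a b
    exact congrFun (congrFun hXV (i, a)) b
  tfae_finish
end

section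
/- Let {A₁,...,A_k} and {B₁,...,B_k} be m×n real matrices. Then {Aᵢ} is simultaneously orthogonally equivalent to {Bᵢ} (i.e., there exist real orthogonal matrices U, V with Uᵀ Aᵢ V = Bᵢ for all i) if and only if tr(w({Aᵢ Aⱼᵀ})) = tr(w({Bᵢ Bⱼᵀ})) for every word w in the products Aᵢ Aⱼᵀ and the corresponding products Bᵢ Bⱼᵀ. -/
open Matrix

theorem exists_isometry_comp_eq {V E : Type*} [AddCommGroup V] [Module ℝ V]
    [NormedAddCommGroup E] [InnerProductSpace ℝ E] [FiniteDimensional ℝ E]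
    (f g : V →ₗ[ℝ] E) (h : ∀ v, ‖f v‖ = ‖g v‖) : ∃ U : E →ₗᵢ[ℝ] E, ∀ v, U (f v) = g v := by
  obtain ⟨s, hs⟩ := f.rangeRestrict.exists_rightInverse_of_surjective f.range_rangeRestrict
  have hs' : ∀ z, f (s z) = z := fun z => congrArg Subtype.val (LinearMap.congr_fun hs z)
  let L : LinearMap.range f →ₗᵢ[ℝ] E :=
    { toLinearMap := g ∘ₗ s
      norm_map' := fun z => by
        rw [LinearMap.comp_apply, ← h, hs']; rfl }
  refine ⟨L.extend, fun v => ?_⟩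
  have h1 : L.extend (f v) = g (s ⟨f v, v, rfl⟩) := L.extend_apply ⟨f v, v, rfl⟩
  rw [h1, ← sub_eq_zero, ← map_sub, ← norm_eq_zero, ← h, map_sub, hs', sub_self, norm_zero]

theorem exists_orthogonal_mul_eq {N n : Type*} [Fintype N] [Fintype n] [DecidableEq n]
    (X Y : Matrix N n ℝ) (h : X * Xᵀ = Y * Yᵀ) :
    ∃ V : Matrix n n ℝ, V * Vᵀ = 1 ∧ X * V = Y := by
  classical
  have key : ∀ (Z : Matrix N n ℝ) (v : EuclideanSpace ℝ N),
      ‖toEuclideanLin Zᵀ v‖ ^ 2 = v.ofLp ⬝ᵥ (Z * Zᵀ) *ᵥ v.ofLp := by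
    intro Z v
    rw [← real_inner_self_eq_norm_sq, EuclideanSpace.inner_eq_star_dotProduct]
    simp [toLpLin_apply, ← mulVec_mulVec, dotProduct_mulVec, mulVec_transpose]
  obtain ⟨U, hU⟩ := exists_isometry_comp_eq (toEuclideanLin Xᵀ) (toEuclideanLin Yᵀ) fun v => by
    rw [← sq_eq_sq₀ (norm_nonneg _) (norm_nonneg _), key, key, h]
  obtain ⟨M, hM⟩ := (toEuclideanLin (𝕜 := ℝ) (m := n) (n := n)).surjective U.toLinearMap
  have hMv : ∀ v, M *ᵥ v = (U (WithLp.toLp 2 v)).ofLp := by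
    intro v
    have := LinearMap.congr_fun hM (WithLp.toLp 2 v)
    simpa [toLpLin_apply] using congrArg WithLp.ofLp this
  have hMM : Mᵀ * M = 1 := by
    ext i j
    have h := U.inner_map_map (EuclideanSpace.single i 1) (EuclideanSpace.single j 1)
    have hcol : ∀ i, (U (EuclideanSpace.single i 1)).ofLp = M.col i := fun i => by
      rw [← mulVec_single_one, hMv, PiLp.toLp_single]
    rw [EuclideanSpace.inner_eq_star_dotProduct, hcol, hcol, dotProduct_comm] at h
    have hij : (Mᵀ * M) i j = star (M.col i) ⬝ᵥ M.col j := rfl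
    rw [hij, h, EuclideanSpace.inner_single_left]
    simp [one_apply]
  refine ⟨Mᵀ, by simpa using hMM, ?_⟩
  rw [← transpose_inj, transpose_mul, transpose_transpose]
  refine Matrix.ext_of_mulVec_single fun s => ?_
  have := hU (WithLp.toLp 2 (Pi.single s 1))
  rw [← mulVec_mulVec, hMv]
  simpa [toLpLin_apply] using congrArg WithLp.ofLp this

section

variable {n : Type*} [Fintype n]

/-- The trace inner product on pairs of square matrices. -/
noncomputable def pairTraceForm (n : Type*) [Fintype n] :
    LinearMap.BilinForm ℝ (Matrix n n ℝ × Matrix n n ℝ) :=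
  LinearMap.mk₂ ℝ (fun X Y => (X.1ᵀ * Y.1).trace + (X.2ᵀ * Y.2).trace)
    (fun X Y Z => by simp [add_mul]; ring) (fun r X Y => by simp [mul_add])
    (fun X Y Z => by simp [mul_add]; ring) (fun r X Y => by simp [mul_add])

lemma pairTraceForm_apply (X Y : Matrix n n ℝ × Matrix n n ℝ) :
    pairTraceForm n X Y = (X.1ᵀ * Y.1).trace + (X.2ᵀ * Y.2).trace := rfl

lemma pairTraceForm_isRefl : (pairTraceForm n).IsRefl := by
  intro X Y h
  rw [pairTraceForm_apply] at h ⊢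
  rw [← h, ← trace_transpose (X.1ᵀ * Y.1), ← trace_transpose (X.2ᵀ * Y.2)]
  simp

lemma pairTraceForm_isCompl_orthogonal (G : Submodule ℝ (Matrix n n ℝ × Matrix n n ℝ)) :
    IsCompl G ((pairTraceForm n).orthogonal G) := by
  rw [LinearMap.BilinForm.isCompl_orthogonal_iff_disjoint pairTraceForm_isRefl,
    Submodule.disjoint_def]
  intro X hX hX'
  have h : (X.1ᵀ * X.1).trace + (X.2ᵀ * X.2).trace = 0 := hX' X hX
  have h1 := (posSemidef_conjTranspose_mul_self X.1).trace_nonneg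
  have h2 := (posSemidef_conjTranspose_mul_self X.2).trace_nonneg
  rw [conjTranspose_eq_transpose_of_trivial] at h1 h2
  refine Prod.ext (trace_conjTranspose_mul_self_eq_zero_iff.1 ?_)
    (trace_conjTranspose_mul_self_eq_zero_iff.1 ?_) <;>
  · rw [conjTranspose_eq_transpose_of_trivial]
    linarith

variable [DecidableEq n]

theorem exists_ne_zero_intertwining (C : Subalgebra ℝ (Matrix n n ℝ × Matrix n n ℝ))
    (hC : ∀ c ∈ C, (c.1ᵀ, c.2ᵀ) ∈ C) (P Q : Matrix n n ℝ)
    (hPP : P * P = P) (hQQ : Q * Q = Q) (hPt : Pᵀ = P) (hQt : Qᵀ = Q)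
    (hP : ∀ c ∈ C, c.1 * P = P * c.1) (hQ : ∀ c ∈ C, c.2 * Q = Q * c.2)
    (htr : ∀ c ∈ C, (c.1 * P).trace = (c.2 * Q).trace) (hQ0 : Q ≠ 0) :
    ∃ T : Matrix n n ℝ, T ≠ 0 ∧ (∀ c ∈ C, T * c.1 = c.2 * T) ∧ T * P = T ∧ Q * T = T := by
  let G : Submodule ℝ (Matrix n n ℝ × Matrix n n ℝ) :=
    (Subalgebra.toSubmodule C).map (LinearMap.mulRight ℝ (P, Q))
  have hG := pairTraceForm_isCompl_orthogonal G
  let π := G.projection _ hG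
  have hπ : ∀ g ∈ G, ∀ o ∈ (pairTraceForm n).orthogonal G, π (g + o) = g := by
    intro g hg o ho
    rw [map_add, Submodule.projection_apply_of_mem_left hG hg,
      Submodule.projection_apply_right hG ⟨o, ho⟩, add_zero]
  have hmul : ∀ c ∈ C, ∀ X, π (c * X) = c * π X := by
    intro c hc X
    have hX : c * X = c * π X + c * (X - π X) := by rw [← mul_add]; simp
    rw [hX]
    apply hπ
    · obtain ⟨d, hd, hd'⟩ := Submodule.projection_apply_mem hG X
      exact ⟨c * d, C.mul_mem hc hd, by
        change c * d * (P, Q) = c * π X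
        rw [mul_assoc]; exact congrArg _ hd'⟩
    · rintro _ ⟨d, hd, rfl⟩
      have h : pairTraceForm n ((c.1ᵀ, c.2ᵀ) * d * (P, Q)) (X - π X) = 0 :=
        Submodule.sub_projection_mem hG X _ ⟨_, C.mul_mem (hC c hc) hd, rfl⟩
      rw [pairTraceForm_apply] at h ⊢
      simpa [mul_assoc] using h
  have hπQ : ∀ X, Q * (π X).2 = (π X).2 := by
    intro X
    obtain ⟨d, hd, hd'⟩ := Submodule.projection_apply_mem hG X
    have h2 : d.2 * Q = (π X).2 := congrArg Prod.snd hd'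
    rw [← h2, ← mul_assoc, ← hQ d hd, mul_assoc, hQQ]
  have hπP : π (P, 0) = (1 / 2 : ℝ) • (P, Q) := by
    have h : ((P, 0) : Matrix n n ℝ × Matrix n n ℝ) =
        (1 / 2 : ℝ) • (P, Q) + (1 / 2 : ℝ) • (P, -Q) := by
      rw [← smul_add]
      ext i j <;> simp
      ring
    rw [h]
    apply hπ
    · exact G.smul_mem _ ⟨1, C.one_mem, by simp⟩
    · refine Submodule.smul_mem _ _ ?_
      rintro _ ⟨d, hd, rfl⟩
      rw [pairTraceForm_apply]
      have := htr _ (hC d hd)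
      have h1 : (P * (d.1ᵀ * P)).trace = (d.1ᵀ * P).trace := by
        rw [trace_mul_comm, mul_assoc, hPP]
      have h2 : (Q * (d.2ᵀ * Q)).trace = (d.2ᵀ * Q).trace := by
        rw [trace_mul_comm, mul_assoc, hQQ]
      simp [hPt, hQt, mul_assoc, h1, h2]
      linarith
  let Φ : Matrix n n ℝ →ₗ[ℝ] Matrix n n ℝ :=
    LinearMap.snd ℝ _ _ ∘ₗ π ∘ₗ LinearMap.inl ℝ _ _ ∘ₗ LinearMap.mulLeft ℝ P
  have hΦ : ∀ X, Φ X = (π (P * X, 0)).2 := fun X => rfl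
  have hΦmul : ∀ c ∈ C, ∀ X, Φ (c.1 * X) = c.2 * Φ X := by
    intro c hc X
    have := congrArg Prod.snd (hmul c hc (P * X, 0))
    simpa [hΦ, ← mul_assoc, ← hP c hc, Prod.mul_def] using this
  have hΦ1 : Φ 1 ≠ 0 := by
    rw [hΦ, mul_one, hπP]
    simpa using hQ0
  obtain ⟨i, j, hij⟩ : ∃ i j : n, ∃ s, Φ (vecMulVec (Pi.single s 1) (Pi.single i 1)) *ᵥ
      Pi.single j 1 ≠ 0 := by
    by_contra! h
    apply hΦ1
    have h0 : Φ = 0 := by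
      apply Matrix.ext_linearMap
      intro s i
      ext : 1
      have : Φ (single s i 1) = 0 := by
        ext r j
        have := congrFun (h i j s) r
        simpa [← single_eq_single_vecMulVec_single] using this
      simpa using this
    simp [h0]
  let τ : (n → ℝ) →ₗ[ℝ] (n → ℝ) :=
    { toFun := fun h => Φ (vecMulVec h (Pi.single i 1)) *ᵥ Pi.single j 1
      map_add' := fun x y => by rw [add_vecMulVec, map_add, add_mulVec]
      map_smul' := fun r x => by rw [smul_vecMulVec, map_smul, smul_mulVec]; rfl }
  have hτ : ∀ h, LinearMap.toMatrix' τ *ᵥ h = Φ (vecMulVec h (Pi.single i 1)) *ᵥ Pi.single j 1 :=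
    fun h => LinearMap.toMatrix'_mulVec τ h
  refine ⟨LinearMap.toMatrix' τ, ?_, ?_, ?_, ?_⟩
  · rintro h0
    obtain ⟨s, hs⟩ := hij
    rw [← hτ, h0, zero_mulVec] at hs
    exact hs rfl
  · intro c hc
    refine Matrix.ext_of_mulVec_single fun s => ?_
    rw [← mulVec_mulVec, ← mulVec_mulVec, hτ, hτ, ← mul_vecMulVec, hΦmul c hc, mulVec_mulVec]
  · refine Matrix.ext_of_mulVec_single fun s => ?_
    rw [← mulVec_mulVec, hτ, hτ, ← mul_vecMulVec, hΦ, hΦ, ← mul_assoc, hPP]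
  · refine Matrix.ext_of_mulVec_single fun s => ?_
    rw [← mulVec_mulVec, hτ, hΦ, mulVec_mulVec, hπQ]

theorem exists_mul_partial_isometry (T : Matrix n n ℝ) (hT : T ≠ 0) :
    ∃ S : Matrix n n ℝ, T * S ≠ 0 ∧ (T * S) * (T * S)ᵀ * (T * S) = T * S ∧
      ∀ M, Commute (Tᵀ * T) M → Commute S M := by
  have hpos : (Tᵀ * T).PosSemidef := by
    simpa using posSemidef_conjTranspose_mul_self T
  have hsa : IsSelfAdjoint (Tᵀ * T) := hpos.isHermitian
  have hcont : ∀ f : ℝ → ℝ, ContinuousOn f (spectrum ℝ (Tᵀ * T)) := fun f =>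
    (Matrix.finite_real_spectrum (A := Tᵀ * T)).continuousOn f
  let g : ℝ → ℝ := fun t => (√t)⁻¹
  have hmul : ∀ f₁ f₂ : ℝ → ℝ, cfc f₁ (Tᵀ * T) * cfc f₂ (Tᵀ * T) =
      cfc (fun t => f₁ t * f₂ t) (Tᵀ * T) := fun f₁ f₂ => (cfc_mul f₁ f₂ _ (hcont _) (hcont _)).symm
  have hid : cfc (fun t : ℝ => t) (Tᵀ * T) = Tᵀ * T := cfc_id' ℝ (Tᵀ * T)
  have hS : (cfc g (Tᵀ * T))ᵀ = cfc g (Tᵀ * T) := by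
    simpa [IsSelfAdjoint, star_eq_conjTranspose] using (cfc_predicate g (Tᵀ * T) : IsSelfAdjoint _)
  have hsq : ∀ t : ℝ, 0 < t → g t * g t * t = 1 := by
    intro t ht
    have h := Real.mul_self_sqrt ht.le
    have h0 : √t ≠ 0 := (Real.sqrt_pos.2 ht).ne'
    change (√t)⁻¹ * (√t)⁻¹ * t = 1
    field_simp
    nlinarith
  refine ⟨cfc g (Tᵀ * T), ?_, ?_, ?_⟩
  · intro h0
    have h1 : Tᵀ * T = 0 := by
      calc Tᵀ * T = cfc (fun t => t * g t * (g t * t)) (Tᵀ * T) := by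
            nth_rw 1 [← hid]
            apply cfc_congr
            intro t ht
            have ht0 : 0 ≤ t := (posSemidef_iff_isHermitian_and_spectrum_nonneg.1 hpos).2 ht
            rcases ht0.eq_or_lt with rfl | ht0
            · simp
            · have := hsq t ht0
              change t = t * g t * (g t * t)
              linear_combination (-t) * this
        _ = Tᵀ * (T * cfc g (Tᵀ * T)) * cfc (fun t => g t * t) (Tᵀ * T) := by
            rw [← mul_assoc]
            nth_rw 2 [← hid]
            rw [hmul, hmul]
        _ = 0 := by rw [h0, mul_zero, zero_mul]
    exact hT (conjTranspose_mul_self_eq_zero.1 (by simpa using h1))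
  · rw [transpose_mul, hS]
    calc T * cfc g (Tᵀ * T) * (cfc g (Tᵀ * T) * Tᵀ) * (T * cfc g (Tᵀ * T))
        = T * (cfc g (Tᵀ * T) * cfc g (Tᵀ * T) * (Tᵀ * T) * cfc g (Tᵀ * T)) := by
          simp only [mul_assoc]
      _ = T * cfc g (Tᵀ * T) := by
          nth_rw 3 [← hid]
          rw [hmul, hmul, hmul]
          congr 2
          funext t
          rcases le_or_gt t 0 with ht | ht
          · simp [g, Real.sqrt_eq_zero_of_nonpos ht]
          · rw [hsq t ht, one_mul]
  · intro M hM
    exact hM.cfc_real g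

theorem exists_orthogonal_intertwining (C : Subalgebra ℝ (Matrix n n ℝ × Matrix n n ℝ))
    (hC : ∀ c ∈ C, (c.1ᵀ, c.2ᵀ) ∈ C) (htr : ∀ c ∈ C, c.1.trace = c.2.trace) :
    ∃ W : Matrix n n ℝ, Wᵀ * W = 1 ∧ ∀ c ∈ C, W * c.1 = c.2 * W := by
  obtain ⟨W, ⟨hW, hWC⟩, hmin⟩ :=
    (InvImage.wf (fun W : Matrix n n ℝ => LinearMap.ker W.mulVecLin) wellFounded_lt).has_min
      {W | W * Wᵀ * W = W ∧ ∀ c ∈ C, W * c.1 = c.2 * W} ⟨0, by simp⟩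
  have hWt : Wᵀ * W * Wᵀ = Wᵀ := by simpa [mul_assoc] using congrArg transpose hW
  have hWC' : ∀ c ∈ C, Wᵀ * c.2 = c.1 * Wᵀ := fun c hc => by
    simpa using (congrArg transpose (hWC _ (hC c hc))).symm
  refine ⟨W, ?_, hWC⟩
  by_contra h1
  set P := 1 - Wᵀ * W with hPdef
  set Q := 1 - W * Wᵀ with hQdef
  have hWP : W * P = 0 := by rw [hPdef, mul_sub, mul_one, ← mul_assoc, hW, sub_self]
  have hWQ : Wᵀ * Q = 0 := by rw [hQdef, mul_sub, mul_one, ← mul_assoc, hWt, sub_self]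
  have hPP : P * P = P := by
    nth_rw 1 [hPdef]
    rw [sub_mul, one_mul, mul_assoc, hWP, mul_zero, sub_zero]
  have hQQ : Q * Q = Q := by
    nth_rw 1 [hQdef]
    rw [sub_mul, one_mul, mul_assoc, hWQ, mul_zero, sub_zero]
  have hPt : Pᵀ = P := by simp [hPdef]
  have hQt : Qᵀ = Q := by simp [hQdef]
  have hP : ∀ c ∈ C, c.1 * P = P * c.1 := fun c hc => by
    rw [hPdef, mul_sub, sub_mul, mul_assoc Wᵀ, hWC c hc, ← mul_assoc, ← hWC' c hc, mul_assoc,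
      mul_one, one_mul]
  have hQ : ∀ c ∈ C, c.2 * Q = Q * c.2 := fun c hc => by
    rw [hQdef, mul_sub, sub_mul, mul_assoc W, hWC' c hc, ← mul_assoc, ← hWC c hc, mul_assoc,
      mul_one, one_mul]
  have htrPQ : ∀ c ∈ C, (c.1 * P).trace = (c.2 * Q).trace := fun c hc => by
    rw [hPdef, hQdef, mul_sub, mul_sub, trace_sub, trace_sub, mul_one, mul_one, htr c hc,
      ← mul_assoc, ← hWC' c hc, trace_mul_comm, ← mul_assoc, trace_mul_comm, ← mul_assoc,
      mul_assoc]
  have hQ0 : Q ≠ 0 := by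
    intro hQ0
    have h := htrPQ 1 C.one_mem
    simp only [Prod.fst_one, Prod.snd_one, one_mul, hQ0, trace_zero] at h
    have hP0 : P = 0 := by
      apply trace_conjTranspose_mul_self_eq_zero_iff.1
      rw [conjTranspose_eq_transpose_of_trivial, hPt, hPP, h]
    exact h1 (sub_eq_zero.1 hP0).symm
  obtain ⟨T, hT0, hTC, hTP, hQT⟩ :=
    exists_ne_zero_intertwining C hC P Q hPP hQQ hPt hQt hP hQ htrPQ hQ0
  obtain ⟨S, hS0, hS, hScomm⟩ := exists_mul_partial_isometry T hT0
  set W' := T * S with hW'def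
  have hTC' : ∀ c ∈ C, Tᵀ * c.2 = c.1 * Tᵀ := fun c hc => by
    simpa using (congrArg transpose (hTC _ (hC c hc))).symm
  have hPT : P * Tᵀ = Tᵀ := by simpa [hPt] using congrArg transpose hTP
  have hW'P : W' * P = W' := by
    rw [hW'def, mul_assoc, (hScomm P ?_).eq, ← mul_assoc, hTP]
    rw [Commute, SemiconjBy, mul_assoc, hTP, ← mul_assoc, hPT]
  have hQW' : Q * W' = W' := by rw [hW'def, ← mul_assoc, hQT]
  have hW'C : ∀ c ∈ C, W' * c.1 = c.2 * W' := fun c hc => by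
    rw [hW'def, mul_assoc, (hScomm c.1 ?_).eq, ← mul_assoc, hTC c hc, mul_assoc]
    rw [Commute, SemiconjBy, mul_assoc, hTC c hc, ← mul_assoc, hTC' c hc, mul_assoc]
  have hWW' : Wᵀ * W' = 0 := by rw [← hQW', ← mul_assoc, hWQ, zero_mul]
  have hW'W : W'ᵀ * W = 0 := by simpa using congrArg transpose hWW'
  have hWW't : W * W'ᵀ = 0 := by
    rw [← hW'P, transpose_mul, hPt, ← mul_assoc, hWP, zero_mul]
  have hW'Wt : W' * Wᵀ = 0 := by simpa using congrArg transpose hWW't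
  refine hmin (W + W') ⟨?_, ?_⟩ ?_
  · have h : (W + W') * (W + W')ᵀ = W * Wᵀ + W' * W'ᵀ := by
      rw [transpose_add, add_mul, mul_add, mul_add, hWW't, hW'Wt, add_zero, zero_add]
    rw [h, add_mul, mul_add, mul_add, hW, hS, mul_assoc W', hW'W, mul_assoc W, hWW', mul_zero,
      mul_zero, add_zero, zero_add]
  · intro c hc
    rw [add_mul, mul_add, hWC c hc, hW'C c hc]
  · refine lt_of_le_of_ne (fun x hx => ?_) fun heq => ?_
    · have hx : (W + W') *ᵥ x = 0 := hx
      have h := congrArg (W *ᵥ Wᵀ *ᵥ ·) hx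
      simpa [mulVec_mulVec, mul_add, ← mul_assoc, hW, mul_assoc W Wᵀ W', hWW'] using h
    · apply hS0
      refine Matrix.ext_of_mulVec_single fun s => ?_
      have hmem : P *ᵥ Pi.single s 1 ∈ LinearMap.ker W.mulVecLin := by
        rw [LinearMap.mem_ker, mulVecLin_apply, mulVec_mulVec, hWP, zero_mulVec]
      have hmem' : P *ᵥ Pi.single s 1 ∈ LinearMap.ker (W + W').mulVecLin := by
        change LinearMap.ker (W + W').mulVecLin = LinearMap.ker W.mulVecLin at heq
        rwa [heq]
      rwa [LinearMap.mem_ker, mulVecLin_apply, mulVec_mulVec, add_mul, hWP, hW'P, zero_add,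
        ← zero_mulVec (Pi.single s 1)] at hmem'

end

theorem orthogonal_equivalence_iff_trace_words (m n k : ℕ)
    (A B : Fin k → Matrix (Fin m) (Fin n) ℝ) :
    (∃ (U : Matrix (Fin m) (Fin m) ℝ) (V : Matrix (Fin n) (Fin n) ℝ),
        U * Uᵀ = 1 ∧ V * Vᵀ = 1 ∧ ∀ i, Uᵀ * A i * V = B i) ↔
      ∀ w : List (Fin k × Fin k),
        ((w.map (fun p => A p.1 * (A p.2)ᵀ)).prod).trace =
          ((w.map (fun p => B p.1 * (B p.2)ᵀ)).prod).trace := by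
  constructor
  · rintro ⟨U, V, hU, hV, hB⟩ w
    have hword : (w.map (fun p => B p.1 * (B p.2)ᵀ)).prod =
        Uᵀ * (w.map (fun p => A p.1 * (A p.2)ᵀ)).prod * U := by
      induction w with
      | nil => simpa using (mul_eq_one_comm.1 hU).symm
      | cons p w ih =>
        have hp : B p.1 * (B p.2)ᵀ = Uᵀ * (A p.1 * (A p.2)ᵀ) * U := by
          rw [← hB, ← hB]
          calc Uᵀ * A p.1 * V * (Uᵀ * A p.2 * V)ᵀ
              = Uᵀ * A p.1 * (V * Vᵀ) * (A p.2)ᵀ * U := by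
                simp only [transpose_mul, transpose_transpose, Matrix.mul_assoc]
            _ = Uᵀ * (A p.1 * (A p.2)ᵀ) * U := by
                rw [hV, Matrix.mul_one, Matrix.mul_assoc Uᵀ]
        rw [List.map_cons, List.map_cons, List.prod_cons, List.prod_cons, ih, hp]
        calc _ = Uᵀ * (A p.1 * (A p.2)ᵀ) * (U * Uᵀ) *
              (w.map (fun p => A p.1 * (A p.2)ᵀ)).prod * U := by simp only [mul_assoc]
          _ = _ := by rw [hU, mul_one, mul_assoc Uᵀ]
    rw [hword, trace_mul_comm, ← mul_assoc, hU, one_mul]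
  · intro h
    let C := Algebra.adjoin ℝ (Set.range fun p : Fin k × Fin k =>
      (A p.1 * (A p.2)ᵀ, B p.1 * (B p.2)ᵀ))
    have hC : ∀ c ∈ C, (c.1ᵀ, c.2ᵀ) ∈ C := by
      intro c hc
      induction hc using Algebra.adjoin_induction with
      | mem x hx =>
        obtain ⟨p, rfl⟩ := hx
        exact Algebra.subset_adjoin ⟨p.swap, by simp⟩
      | algebraMap r => simpa [algebraMap_eq_diagonal] using C.algebraMap_mem r
      | add x y _ _ hx hy => simpa using C.add_mem hx hy
      | mul x y _ _ hx hy => simpa using C.mul_mem hy hx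
    have htr : ∀ c ∈ C, c.1.trace = c.2.trace := by
      intro c hc
      rw [← Subalgebra.mem_toSubmodule, Algebra.adjoin_eq_span] at hc
      induction hc using Submodule.span_induction with
      | mem x hx =>
        obtain ⟨w, rfl⟩ : ∃ w : List (Fin k × Fin k),
            ((w.map (fun p => A p.1 * (A p.2)ᵀ)).prod,
              (w.map (fun p => B p.1 * (B p.2)ᵀ)).prod) = x := by
          induction hx using Submonoid.closure_induction with
          | mem x hx =>
            obtain ⟨p, rfl⟩ := hx
            exact ⟨[p], by simp⟩
          | one => exact ⟨[], rfl⟩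
          | mul x y _ _ hx hy =>
            obtain ⟨u, rfl⟩ := hx
            obtain ⟨v, rfl⟩ := hy
            exact ⟨u ++ v, by simp⟩
        exact h w
      | zero => simp
      | add x y _ _ hx hy => simp [hx, hy]
      | smul r x _ hx => simp [hx]
    obtain ⟨W, hW, hWC⟩ := exists_orthogonal_intertwining C hC htr
    have hgram : ∀ i j, W * A i * (W * A j)ᵀ = B i * (B j)ᵀ := by
      intro i j
      have hij : W * (A i * (A j)ᵀ) = B i * (B j)ᵀ * W :=
        hWC _ (Algebra.subset_adjoin ⟨(i, j), rfl⟩)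
      rw [transpose_mul, ← Matrix.mul_assoc, Matrix.mul_assoc W, hij, Matrix.mul_assoc,
        mul_eq_one_comm.1 hW, Matrix.mul_one]
    obtain ⟨V, hV, hXV⟩ := exists_orthogonal_mul_eq
      (Matrix.of fun p : Fin k × Fin m => (W * A p.1) p.2) (Matrix.of fun p => B p.1 p.2) (by
        ext p q
        exact congrFun (congrFun (hgram p.1 q.1) p.2) q.2)
    refine ⟨Wᵀ, V, by simpa using hW, hV, fun i => ?_⟩
    ext r s
    rw [transpose_transpose]
    exact congrFun (congrFun hXV (i, r)) s
end
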